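/- The quotient of the exterior algebra Λ(Q^n) by the ideal I_n generated by F_1,...,F_n has Q-dimension equal to C(n, ⌊n/2⌋), and its Hilbert series (grading by degree) is Σ_{k=0}^{⌊n/2⌋} (C(n,k) - C(n,k-1)) q^k. -/

import Mathlib

open ExteriorAlgebra

/-- The generator `θ_i` of the exterior algebra `Λ(ℚ^n)`. -/
noncomputable def theta (n : ℕ) (i : Fin n) : ExteriorAlgebra ℚ (Fin n → ℚ) :=
  ExteriorAlgebra.ι ℚ (Pi.single i (1 : ℚ))

/-- For `A = {a_1 < a_2 < ⋯ < a_k} ⊆ [n]`, the monomial `θ_A = θ_{a_1} θ_{a_2} ⋯ θ_{a_k}`. -/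
noncomputable def thetaA (n : ℕ) (A : Finset (Fin n)) : ExteriorAlgebra ℚ (Fin n → ℚ) :=
  ((A.sort (· ≤ ·)).map (theta n)).prod

/-- The fundamental quasisymmetric invariant `F_{1^r} = Σ_{A ⊆ [n], |A| = r} θ_A`. -/
noncomputable def Fq (n r : ℕ) : ExteriorAlgebra ℚ (Fin n → ℚ) :=
  ∑ A ∈ Finset.powersetCard r (Finset.univ : Finset (Fin n)), thetaA n A
/-- The two-sided ideal `I_n` generated by `F_1, …, F_n`, viewed as a `ℚ`-subspace of
`Λ(ℚ^n)` (the ideal is closed under `ℚ`-scaling, so the span adds nothing). -/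
noncomputable def In (n : ℕ) : Submodule ℚ (ExteriorAlgebra ℚ (Fin n → ℚ)) :=
  Submodule.span ℚ
    ((TwoSidedIdeal.span {x | ∃ r : ℕ, 1 ≤ r ∧ r ≤ n ∧ x = Fq n r} :
      TwoSidedIdeal (ExteriorAlgebra ℚ (Fin n → ℚ))) :
        Set (ExteriorAlgebra ℚ (Fin n → ℚ)))

/-- The degree-`k` graded piece of the exterior algebra: the `k`-th power of the
subspace spanned by the generators. -/
noncomputable def gradePiece (n k : ℕ) : Submodule ℚ (ExteriorAlgebra ℚ (Fin n → ℚ)) :=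
  (LinearMap.range (ExteriorAlgebra.ι ℚ :
    (Fin n → ℚ) →ₗ[ℚ] ExteriorAlgebra ℚ (Fin n → ℚ))) ^ k

section Lefschetz

variable {M : Type*} [AddCommGroup M] [Module ℚ M]

lemma lef_comm (L S K : Module.End ℚ M) (μ : ℚ)
    (hc : ∀ a, S (L a) = μ • a - K a + L (S a))
    (hKS : ∀ a, K (S a) = S (K a) - (2 : ℚ) • S a)
    (a : M) (p : ℚ) (ha : K a = p • a) (j : ℕ) :
    K ((S ^ j) a) = (p - 2 * j) • (S ^ j) a ∧
    L ((S ^ (j + 1)) a) = (S ^ (j + 1)) (L a) + (((j : ℚ) + 1) * (p - μ - j)) • (S ^ j) a := by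
  have h1 : ∀ j : ℕ, K ((S ^ j) a) = (p - 2 * j) • (S ^ j) a := by
    intro j
    induction j with
    | zero => simp [ha]
    | succ j ih =>
      rw [pow_succ', Module.End.mul_apply, hKS, ih, map_smul]
      push_cast
      module
  refine ⟨h1 j, ?_⟩
  induction j with
  | zero =>
    simp only [zero_add, pow_one, pow_zero, Module.End.one_apply]
    rw [hc, ha]
    push_cast
    module
  | succ j ih =>
    have h2 := hc ((S ^ (j + 1)) a)
    rw [ih, h1 (j + 1), map_add, map_smul] at h2
    rw [pow_succ' S (j + 1), Module.End.mul_apply, Module.End.mul_apply]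
    have e : S ((S ^ j) a) = (S ^ (j + 1)) a := by rw [pow_succ', Module.End.mul_apply]
    rw [e] at h2
    have h3 : L (S ((S ^ (j + 1)) a)) = S ((S ^ (j + 1)) (L a)) +
        (((j : ℚ) + 1) * (p - μ - j)) • (S ^ (j + 1)) a - μ • (S ^ (j + 1)) a
        + (p - 2 * ((j + 1 : ℕ) : ℚ)) • (S ^ (j + 1)) a := by
      rw [h2]; abel
    rw [h3]
    push_cast
    module

lemma eventually_zero [Module.Finite ℚ M] (K : Module.End ℚ M) (s : ℕ → M) (c : ℕ → ℚ)
    (hc : Function.Injective c) (h : ∀ j, K (s j) = c j • s j) : ∃ j, s j = 0 := by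
  by_contra! hne
  have : Set.range c ⊆ {μ | K.HasEigenvalue μ} := by
    rintro _ ⟨j, rfl⟩
    exact Module.End.hasEigenvalue_of_hasEigenvector
      (Module.End.hasEigenvector_iff.2 ⟨Module.End.mem_eigenspace_iff.2 (h j), hne j⟩)
  exact Set.infinite_range_of_injective hc (K.finite_hasEigenvalue.subset this)

lemma lef_inj [Module.Finite ℚ M] (L S K : Module.End ℚ M) (μ : ℚ)
    (hc : ∀ a, S (L a) = μ • a - K a + L (S a))
    (hKS : ∀ a, K (S a) = S (K a) - (2 : ℚ) • S a)
    (a : M) (p : ℚ) (ha : K a = p • a) (hp : p < μ) (hL : L a = 0) : a = 0 := by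
  have H := lef_comm L S K μ hc hKS a p ha
  obtain ⟨j, hj⟩ := eventually_zero K (fun j => (S ^ j) a) (fun j => p - 2 * j)
    (by intro i j h; simpa using h) (fun j => (H j).1)
  induction j with
  | zero => simpa using hj
  | succ j ih =>
    apply ih
    have h := (H j).2
    rw [hj, hL, map_zero, map_zero, zero_add] at h
    have hne : (((j : ℚ) + 1) * (p - μ - j)) ≠ 0 := by
      have : (0 : ℚ) ≤ j := by positivity
      apply mul_ne_zero <;> linarith
    exact (smul_eq_zero.1 h.symm).resolve_left hne

lemma lef_surj [Module.Finite ℚ M] (L S K : Module.End ℚ M) (μ : ℚ)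
    (hc : ∀ a, S (L a) = μ • a - K a + L (S a))
    (hKS : ∀ a, K (S a) = S (K a) - (2 : ℚ) • S a)
    (hKL : ∀ a, K (L a) = L (K a) + (2 : ℚ) • L a)
    (a : M) (p : ℚ) (ha : K a = p • a) (hp : μ < p) : a ∈ LinearMap.range L := by
  have h1 : ∀ j : ℕ, K ((L ^ j) a) = (p + 2 * j) • (L ^ j) a := by
    intro j
    induction j with
    | zero => simp [ha]
    | succ j ih =>
      rw [pow_succ', Module.End.mul_apply, hKL, ih, map_smul]
      push_cast
      module
  obtain ⟨j, hj⟩ := eventually_zero K (fun j => (L ^ j) a) (fun j => p + 2 * j)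
    (by intro i j h; simpa using h) h1
  have key : ∀ j : ℕ, (S ^ j) ((L ^ j) a) ∈ LinearMap.range L → a ∈ LinearMap.range L := by
    intro j
    induction j with
    | zero => simp
    | succ j ih =>
      intro hm
      apply ih
      have h := (lef_comm L S K μ hc hKS ((L ^ j) a) _ (h1 j) j).2
      have e : L ((L ^ j) a) = (L ^ (j + 1)) a := by rw [pow_succ', Module.End.mul_apply]
      rw [e] at h
      have hne : (((j : ℚ) + 1) * (p + 2 * j - μ - j)) ≠ 0 := by
        have : (0 : ℚ) ≤ j := by positivity
        apply mul_ne_zero <;> linarith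
      have h5 : (((j : ℚ) + 1) * (p + 2 * j - μ - j)) • (S ^ j) ((L ^ j) a)
          ∈ LinearMap.range L := by
        rw [← sub_eq_iff_eq_add'] at h
        rw [← h]
        exact Submodule.sub_mem _ ⟨_, rfl⟩ hm
      exact (Submodule.smul_mem_iff _ hne).1 h5
  apply key j
  rw [hj, map_zero]
  exact Submodule.zero_mem _

end Lefschetz
section Ext

variable {V : Type*} [AddCommGroup V] [Module ℚ V]

/-- Contraction of the exterior algebra by a functional. -/
noncomputable def ct (h : Module.Dual ℚ V) : Module.End ℚ (ExteriorAlgebra ℚ V) :=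
  CliffordAlgebra.contractLeft (Q := (0 : QuadraticForm ℚ V)) h

/-- Short name for the inclusion of vectors. -/
noncomputable abbrev io (v : V) : ExteriorAlgebra ℚ V := ExteriorAlgebra.ι ℚ v

lemma ct_mul (h : Module.Dual ℚ V) (v : V) (a : ExteriorAlgebra ℚ V) :
    ct h (io v * a) = h v • a - io v * ct h a :=
  CliffordAlgebra.contractLeft_ι_mul h v a

lemma ct_one (h : Module.Dual ℚ V) : ct h (1 : ExteriorAlgebra ℚ V) = 0 :=
  CliffordAlgebra.contractLeft_one (Q := (0 : QuadraticForm ℚ V)) h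

lemma ct_ct (h : Module.Dual ℚ V) (a : ExteriorAlgebra ℚ V) : ct h (ct h a) = 0 :=
  CliffordAlgebra.contractLeft_contractLeft h a

lemma ct_comm (h h' : Module.Dual ℚ V) (a : ExteriorAlgebra ℚ V) :
    ct h (ct h' a) = - ct h' (ct h a) :=
  CliffordAlgebra.contractLeft_comm h h' a

lemma io_sq (v : V) : io v * io v = 0 := ExteriorAlgebra.ι_sq_zero v

lemma io_anti (v w : V) : io v * io w = - (io w * io v) :=
  eq_neg_of_add_eq_zero_left (ExteriorAlgebra.ι_add_mul_swap v w)

lemma io_sq' (v : V) (a : ExteriorAlgebra ℚ V) : io v * (io v * a) = 0 := by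
  rw [← mul_assoc, io_sq, zero_mul]

lemma io_anti' (v w : V) (a : ExteriorAlgebra ℚ V) :
    io v * (io w * a) = - (io w * (io v * a)) := by
  rw [← mul_assoc, io_anti, neg_mul, mul_assoc]

/-- Normal form data. -/
structure NF (V : Type*) [AddCommGroup V] [Module ℚ V] (m : ℕ) where
  x : Fin m → V
  y : Fin m → V
  z : V
  u : V
  f : Fin m → Module.Dual ℚ V
  g : Fin m → Module.Dual ℚ V
  ζ : Module.Dual ℚ V
  υ : Module.Dual ℚ V
  fx : ∀ i j, f i (x j) = if i = j then 1 else 0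
  fy : ∀ i j, f i (y j) = 0
  gx : ∀ i j, g i (x j) = 0
  gy : ∀ i j, g i (y j) = if i = j then 1 else 0
  fz : ∀ i, f i z = 0
  gz : ∀ i, g i z = 0
  fu : ∀ i, f i u = 0
  gu : ∀ i, g i u = 0
  ζx : ∀ i, ζ (x i) = 0
  ζy : ∀ i, ζ (y i) = 0
  ζz : ζ z = 1
  ζu : ζ u = 0
  υx : ∀ i, υ (x i) = 0
  υy : ∀ i, υ (y i) = 0
  υz : υ z = 0
  υu : υ u • u = u
  tot : ∀ v, ∑ i, (f i v • x i + g i v • y i) + ζ v • z + υ v • u = v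

namespace NF

variable {m : ℕ} (B : NF V m)

/-- The two-form. -/
noncomputable def om : ExteriorAlgebra ℚ V := ∑ i, io (B.x i) * io (B.y i)

/-- Number operator of the pairs. -/
noncomputable def K : Module.End ℚ (ExteriorAlgebra ℚ V) :=
  ∑ i, (LinearMap.mulLeft ℚ (io (B.x i)) * ct (B.f i) + LinearMap.mulLeft ℚ (io (B.y i)) * ct (B.g i))

/-- Lowering operator. -/
noncomputable def S : Module.End ℚ (ExteriorAlgebra ℚ V) := ∑ i, ct (B.g i) * ct (B.f i)

/-- Number operator of `u`. -/
noncomputable def U : Module.End ℚ (ExteriorAlgebra ℚ V) := LinearMap.mulLeft ℚ (io B.u) * ct B.υ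

lemma K_apply (a : ExteriorAlgebra ℚ V) :
    B.K a = ∑ i, (io (B.x i) * ct (B.f i) a + io (B.y i) * ct (B.g i) a) := by
  simp [K, LinearMap.sum_apply]

lemma S_apply (a : ExteriorAlgebra ℚ V) : B.S a = ∑ i, ct (B.g i) (ct (B.f i) a) := by
  simp [S, LinearMap.sum_apply]

lemma U_apply (a : ExteriorAlgebra ℚ V) : B.U a = io B.u * ct B.υ a := rfl

lemma om_comm (v : V) : io v * B.om = B.om * io v := by
  simp only [om, Finset.mul_sum, Finset.sum_mul]
  refine Finset.sum_congr rfl fun i _ => ?_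
  rw [io_anti', mul_assoc, io_anti v, mul_neg, neg_neg]

lemma om_comm' (v : V) (a : ExteriorAlgebra ℚ V) : io v * (B.om * a) = B.om * (io v * a) := by
  rw [← mul_assoc, om_comm, mul_assoc]

lemma ct_om (h : Module.Dual ℚ V) (a : ExteriorAlgebra ℚ V) :
    ct h (B.om * a) = ∑ i, (h (B.x i) • (io (B.y i) * a) - h (B.y i) • (io (B.x i) * a))
      + B.om * ct h a := by
  simp only [om, Finset.sum_mul, map_sum, mul_assoc, ct_mul, ← Finset.sum_add_distrib]
  refine Finset.sum_congr rfl fun i _ => ?_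
  rw [mul_sub, mul_smul_comm]
  abel

lemma ctf_om (j : Fin m) (a : ExteriorAlgebra ℚ V) :
    ct (B.f j) (B.om * a) = io (B.y j) * a + B.om * ct (B.f j) a := by
  rw [ct_om]; simp [B.fx, B.fy]

lemma ctg_om (j : Fin m) (a : ExteriorAlgebra ℚ V) :
    ct (B.g j) (B.om * a) = - (io (B.x j) * a) + B.om * ct (B.g j) a := by
  rw [ct_om]; simp [B.gx, B.gy]

lemma ctζ_om (a : ExteriorAlgebra ℚ V) : ct B.ζ (B.om * a) = B.om * ct B.ζ a := by
  rw [ct_om]; simp [B.ζx, B.ζy]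

lemma ctυ_om (a : ExteriorAlgebra ℚ V) : ct B.υ (B.om * a) = B.om * ct B.υ a := by
  rw [ct_om]; simp [B.υx, B.υy]

lemma ct_K (h : Module.Dual ℚ V) (a : ExteriorAlgebra ℚ V) :
    ct h (B.K a) = ∑ i, (h (B.x i) • ct (B.f i) a + h (B.y i) • ct (B.g i) a)
      + B.K (ct h a) := by
  simp only [K_apply, map_sum, map_add, ct_mul, ← Finset.sum_add_distrib]
  refine Finset.sum_congr rfl fun i _ => ?_
  rw [ct_comm h (B.f i), ct_comm h (B.g i), mul_neg, mul_neg]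
  abel

lemma ctf_K (j : Fin m) (a : ExteriorAlgebra ℚ V) :
    ct (B.f j) (B.K a) = ct (B.f j) a + B.K (ct (B.f j) a) := by
  rw [ct_K]; simp [B.fx, B.fy]

lemma ctg_K (j : Fin m) (a : ExteriorAlgebra ℚ V) :
    ct (B.g j) (B.K a) = ct (B.g j) a + B.K (ct (B.g j) a) := by
  rw [ct_K]; simp [B.gx, B.gy]

lemma ctυ_K (a : ExteriorAlgebra ℚ V) : ct B.υ (B.K a) = B.K (ct B.υ a) := by
  rw [ct_K]; simp [B.υx, B.υy]

lemma hKS (a : ExteriorAlgebra ℚ V) : B.K (B.S a) = B.S (B.K a) - (2 : ℚ) • B.S a := by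
  simp only [S_apply, ctf_K, ctg_K, map_add, map_sum, Finset.sum_add_distrib]
  module

lemma hKL (a : ExteriorAlgebra ℚ V) :
    B.K (B.om * a) = B.om * B.K a + (2 : ℚ) • (B.om * a) := by
  have h1 : B.om * a = ∑ i, io (B.x i) * (io (B.y i) * a) := by
    simp only [om, Finset.sum_mul, mul_assoc]
  have h2 : (2 : ℚ) • (B.om * a) = ∑ i, (2 : ℚ) • (io (B.x i) * (io (B.y i) * a)) := by
    rw [h1, Finset.smul_sum]
  rw [h2]
  simp only [K_apply, ctf_om, ctg_om, Finset.mul_sum, ← Finset.sum_add_distrib]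
  refine Finset.sum_congr rfl fun i _ => ?_
  rw [mul_add, mul_add, om_comm', om_comm', mul_neg, io_anti' (B.y i), neg_neg, mul_add]
  module

lemma hc (a : ExteriorAlgebra ℚ V) :
    B.S (B.om * a) = (m : ℚ) • a - B.K a + B.om * B.S a := by
  have h2 : (m : ℚ) • a = ∑ i : Fin m, a := by simp [Nat.cast_smul_eq_nsmul]
  rw [h2]
  simp only [S_apply, K_apply, ctf_om, ctg_om, map_add, ct_mul, Finset.mul_sum,
    ← Finset.sum_add_distrib, ← Finset.sum_sub_distrib]
  refine Finset.sum_congr rfl fun i _ => ?_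
  rw [B.gy, if_pos rfl, one_smul]
  abel

lemma K_u (a : ExteriorAlgebra ℚ V) : B.K (io B.u * a) = io B.u * B.K a := by
  simp only [K_apply, ct_mul, B.fu, B.gu, zero_smul, zero_sub, Finset.mul_sum, mul_add, mul_neg]
  refine Finset.sum_congr rfl fun i _ => ?_
  rw [io_anti' B.u, io_anti' B.u]

lemma K_U (a : ExteriorAlgebra ℚ V) : B.K (B.U a) = B.U (B.K a) := by
  rw [U_apply, U_apply, K_u, ctυ_K]

lemma U_U (a : ExteriorAlgebra ℚ V) : B.U (B.U a) = B.U a := by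
  rw [U_apply, U_apply, ct_mul, ct_ct, mul_zero, sub_zero, mul_smul_comm, ← smul_mul_assoc,
    io, ← map_smul, B.υu]

lemma om_U (a : ExteriorAlgebra ℚ V) : B.om * (B.U a) = B.U (B.om * a) := by
  rw [U_apply, U_apply, ctυ_om, om_comm']

lemma inj_aux [Module.Finite ℚ (ExteriorAlgebra ℚ V)] (b : ExteriorAlgebra ℚ V) (p : ℚ)
    (hp : p < m) (hb : B.K b + B.U b = p • b) (h0 : B.om * b = 0) : b = 0 := by
  have hK : B.K b = p • b - B.U b := eq_sub_of_add_eq hb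
  have hKU : B.K (B.U b) = (p - 1) • B.U b := by
    rw [K_U, hK, map_sub, map_smul, U_U]; module
  have e1 : B.U b = 0 := by
    refine lef_inj (LinearMap.mulLeft ℚ B.om) B.S B.K m (fun a => B.hc a) (fun a => B.hKS a)
      (B.U b) (p - 1) hKU (by linarith) ?_
    rw [LinearMap.mulLeft_apply, om_U, h0, map_zero]
  rw [e1, sub_zero] at hK
  exact lef_inj (LinearMap.mulLeft ℚ B.om) B.S B.K m (fun a => B.hc a) (fun a => B.hKS a)
      b p hK hp h0

lemma surj_aux [Module.Finite ℚ (ExteriorAlgebra ℚ V)] (b : ExteriorAlgebra ℚ V) (p : ℚ)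
    (hp : m < p) (hp' : B.u = 0 ∨ m < p - 1) (hb : B.K b + B.U b = p • b) :
    ∃ c, b = B.om * c := by
  have hK : B.K b = p • b - B.U b := eq_sub_of_add_eq hb
  have hKU : B.K (B.U b) = (p - 1) • B.U b := by
    rw [K_U, hK, map_sub, map_smul, U_U]; module
  have hKU' : B.K (b - B.U b) = p • (b - B.U b) := by
    rw [map_sub, hKU, hK]; module
  have e1 : b - B.U b ∈ LinearMap.range (LinearMap.mulLeft ℚ B.om) :=
    lef_surj (LinearMap.mulLeft ℚ B.om) B.S B.K m (fun a => B.hc a) (fun a => B.hKS a)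
      (fun a => B.hKL a) _ p hKU' hp
  have e2 : B.U b ∈ LinearMap.range (LinearMap.mulLeft ℚ B.om) := by
    rcases hp' with h | h
    · rw [U_apply, h, io, map_zero, zero_mul]; exact Submodule.zero_mem _
    · exact lef_surj (LinearMap.mulLeft ℚ B.om) B.S B.K m (fun a => B.hc a) (fun a => B.hKS a)
        (fun a => B.hKL a) _ (p - 1) hKU h
  have e3 := Submodule.add_mem _ e1 e2
  rw [sub_add_cancel] at e3
  obtain ⟨c, hc⟩ := e3
  exact ⟨c, hc.symm⟩

/-- number operator on graded pieces -/
lemma number (k : ℕ) (a : ExteriorAlgebra ℚ V) (ha : a ∈ ⋀[ℚ]^k V) :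
    B.K a + io B.z * ct B.ζ a + B.U a = (k : ℚ) • a := by
  revert ha
  induction k generalizing a with
  | zero =>
    intro ha
    rw [exteriorPower, pow_zero, Submodule.mem_one] at ha
    obtain ⟨r, rfl⟩ := ha
    simp [Algebra.algebraMap_eq_smul_one, K_apply, U_apply, ct_one]
  | succ k ih =>
    intro ha
    rw [exteriorPower, pow_succ'] at ha
    induction ha using Submodule.mul_induction_on' with
    | mem_mul_mem v hv w hw =>
      obtain ⟨v, rfl⟩ := hv
      have h := ih w hw
      have ht := congrArg (fun t => io t * w) (B.tot v)
      simp only [io, map_add, map_sum, map_smul, add_mul, Finset.sum_mul, smul_mul_assoc] at ht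
      have e : B.K (io v * w) + io B.z * ct B.ζ (io v * w) + B.U (io v * w)
        = io v * w + io v * (B.K w + io B.z * ct B.ζ w + B.U w) := by
        conv_rhs => rw [← ht]
        simp only [K_apply, U_apply, ct_mul, mul_sub, mul_smul_comm, mul_add, Finset.mul_sum,
          io_anti' v]
        simp only [Finset.sum_add_distrib, Finset.sum_sub_distrib, Finset.sum_neg_distrib]
        abel
      change B.K (io v * w) + io B.z * ct B.ζ (io v * w) + B.U (io v * w) = _ • (io v * w)
      rw [e, h, mul_smul_comm]
      push_cast
      module
    | add a _ b _ h1 h2 =>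
      rw [map_add, map_add, map_add, smul_add, ← h1, ← h2, mul_add]
      abel

end NF

lemma ct_grade (h : Module.Dual ℚ V) (k : ℕ) (a : ExteriorAlgebra ℚ V)
    (ha : a ∈ ⋀[ℚ]^(k + 1) V) : ct h a ∈ ⋀[ℚ]^k V := by
  revert ha
  induction k generalizing a with
  | zero =>
    intro ha
    rw [exteriorPower, zero_add, pow_one] at ha
    obtain ⟨v, rfl⟩ := ha
    have := ct_mul h v 1
    rw [mul_one, ct_one, mul_zero, sub_zero] at this
    erw [this]
    rw [exteriorPower, pow_zero, Submodule.mem_one]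
    exact ⟨h v, by rw [Algebra.algebraMap_eq_smul_one]⟩
  | succ k ih =>
    intro ha
    rw [exteriorPower, pow_succ'] at ha
    induction ha using Submodule.mul_induction_on' with
    | mem_mul_mem v hv w hw =>
      obtain ⟨v, rfl⟩ := hv
      change ct h (io v * w) ∈ _
      rw [ct_mul]
      refine Submodule.sub_mem _ (Submodule.smul_mem _ _ hw) ?_
      rw [exteriorPower, pow_succ']
      exact Submodule.mul_mem_mul ⟨v, rfl⟩ (ih w hw)
    | add a _ b _ h1 h2 =>
      rw [map_add]
      exact Submodule.add_mem _ h1 h2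

lemma ct_grade_zero (h : Module.Dual ℚ V) (a : ExteriorAlgebra ℚ V)
    (ha : a ∈ ⋀[ℚ]^0 V) : ct h a = 0 := by
  rw [exteriorPower, pow_zero, Submodule.mem_one] at ha
  obtain ⟨r, rfl⟩ := ha
  simp [Algebra.algebraMap_eq_smul_one, ct_one]

lemma io_grade (v : V) (k : ℕ) (a : ExteriorAlgebra ℚ V)
    (ha : a ∈ ⋀[ℚ]^k V) : io v * a ∈ ⋀[ℚ]^(k + 1) V := by
  rw [exteriorPower, pow_succ']
  exact Submodule.mul_mem_mul ⟨v, rfl⟩ ha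

namespace NF

variable {m : ℕ} (B : NF V m)

lemma om_grade (k : ℕ) (a : ExteriorAlgebra ℚ V)
    (ha : a ∈ ⋀[ℚ]^k V) : B.om * a ∈ ⋀[ℚ]^(k + 2) V := by
  rw [om, Finset.sum_mul]
  refine Submodule.sum_mem _ fun i _ => ?_
  rw [mul_assoc]
  exact io_grade _ _ _ (io_grade _ _ _ ha)

/-- The odd operator with image the ideal. -/
noncomputable def D : Module.End ℚ (ExteriorAlgebra ℚ V) :=
  LinearMap.mulLeft ℚ (io B.z) + LinearMap.mulLeft ℚ B.om * ct B.ζ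

lemma D_apply (a : ExteriorAlgebra ℚ V) : B.D a = io B.z * a + B.om * ct B.ζ a := rfl

lemma D_grade (k : ℕ) (a : ExteriorAlgebra ℚ V)
    (ha : a ∈ ⋀[ℚ]^k V) : B.D a ∈ ⋀[ℚ]^(k + 1) V := by
  rw [D_apply]
  refine Submodule.add_mem _ (io_grade _ _ _ ha) ?_
  cases k with
  | zero => rw [ct_grade_zero _ _ ha, mul_zero]; exact Submodule.zero_mem _
  | succ k => exact B.om_grade _ _ (ct_grade _ _ _ ha)

lemma z_mem (a : ExteriorAlgebra ℚ V) : io B.z * a ∈ LinearMap.range B.D := by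
  refine ⟨ct B.ζ (io B.z * a), ?_⟩
  rw [D_apply, ct_ct, mul_zero, add_zero, ct_mul, mul_sub, io_sq', sub_zero, B.ζz, one_smul]

lemma om_mem (b : ExteriorAlgebra ℚ V) : B.om * b ∈ LinearMap.range B.D := by
  have : B.om * b = B.D (io B.z * b) + io B.z * (B.om * ct B.ζ b) := by
    rw [D_apply, io_sq', zero_add, ct_mul, B.ζz, one_smul, mul_sub, om_comm']
    abel
  rw [this]
  exact Submodule.add_mem _ ⟨_, rfl⟩ (B.z_mem _)

lemma mem_range (a : ExteriorAlgebra ℚ V) :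
    a ∈ LinearMap.range B.D ↔ ∃ b c, a = io B.z * b + B.om * c := by
  constructor
  · rintro ⟨b, rfl⟩; exact ⟨b, _, rfl⟩
  · rintro ⟨b, c, rfl⟩
    exact Submodule.add_mem _ (B.z_mem _) (B.om_mem _)

lemma range_mul_right (a c : ExteriorAlgebra ℚ V) (ha : a ∈ LinearMap.range B.D) :
    a * c ∈ LinearMap.range B.D := by
  rw [mem_range] at ha ⊢
  obtain ⟨b, d, rfl⟩ := ha
  exact ⟨b * c, d * c, by rw [add_mul, mul_assoc, mul_assoc]⟩

lemma range_mul_left (c a : ExteriorAlgebra ℚ V) (ha : a ∈ LinearMap.range B.D) :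
    c * a ∈ LinearMap.range B.D := by
  induction c using CliffordAlgebra.left_induction with
  | algebraMap r => 
    erw [← Algebra.smul_def]
    exact Submodule.smul_mem _ _ ha
  | add x y hx hy => rw [add_mul]; exact Submodule.add_mem _ hx hy
  | ι_mul x v h =>
    change io v * x * a ∈ _
    rw [mem_range] at h ⊢
    obtain ⟨b, d, hb⟩ := h
    refine ⟨- (io v * b), io v * d, ?_⟩
    rw [mul_assoc, hb, mul_add, io_anti', om_comm', mul_neg]

lemma D_inj [Module.Finite ℚ (ExteriorAlgebra ℚ V)] (j : ℕ) (hj : j ≤ m)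
    (a : ExteriorAlgebra ℚ V) (ha : a ∈ ⋀[ℚ]^j V) (h : B.D a = 0) : a = 0 := by
  have h1 := congrArg (ct B.ζ) h
  rw [D_apply, map_add, ctζ_om, ct_ct, mul_zero, add_zero, map_zero, ct_mul, B.ζz, one_smul,
    sub_eq_zero] at h1
  rw [D_apply] at h
  have h2 : io B.z * a = 0 := by rw [h1, io_sq']
  rw [h2, zero_add] at h
  cases j with
  | zero => rw [h1, ct_grade_zero _ _ ha, mul_zero]
  | succ j =>
    have hN := B.number j _ (ct_grade B.ζ j a ha)
    rw [ct_ct, mul_zero, add_zero] at hN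
    have : ct B.ζ a = 0 := B.inj_aux _ j (by exact_mod_cast hj) hN h
    rw [h1, this, mul_zero]

lemma D_surj [Module.Finite ℚ (ExteriorAlgebra ℚ V)] (k : ℕ) (hk : m < k)
    (hk' : B.u = 0 ∨ m + 1 < k)
    (a : ExteriorAlgebra ℚ V) (ha : a ∈ ⋀[ℚ]^k V) : a ∈ LinearMap.range B.D := by
  rw [mem_range]
  have hN := B.number k _ (ct_grade B.ζ k _ (io_grade B.z k a ha))
  rw [ct_ct, mul_zero, add_zero] at hN
  obtain ⟨c, hc⟩ := B.surj_aux _ k (by exact_mod_cast hk)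
    (hk'.imp id fun h => by rw [lt_sub_iff_add_lt]; exact_mod_cast h) hN
  refine ⟨ct B.ζ a, c, ?_⟩
  rw [← hc, ct_mul, B.ζz, one_smul]
  abel

end NF

end Ext
section Seq

variable {V : Type*} [AddCommGroup V] [Module ℚ V]

/-- Elementary functions in a sequence of anticommuting vectors. -/
noncomputable def Es (t : ℕ → V) : ℕ → ℕ → ExteriorAlgebra ℚ V
  | _, 0 => 1
  | 0, _ + 1 => 0
  | k + 1, r + 1 => Es t k (r + 1) + Es t k r * io (t k)

/-- Partial sums. -/
noncomputable def Ps (t : ℕ → V) (k : ℕ) : V := ∑ j ∈ Finset.range k, t j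

lemma Es_zero (t : ℕ → V) (k : ℕ) : Es t k 0 = 1 := by cases k <;> rfl

lemma Es_succ (t : ℕ → V) (k r : ℕ) :
    Es t (k + 1) (r + 1) = Es t k (r + 1) + Es t k r * io (t k) := rfl

lemma Es_one (t : ℕ → V) (k : ℕ) : Es t k 1 = io (Ps t k) := by
  induction k with
  | zero => simp [Es, Ps]
  | succ k ih => 
    have hP : Ps t (k + 1) = Ps t k + t k := Finset.sum_range_succ _ _
    rw [Es_succ, ih, Es_zero, one_mul, hP]
    exact (map_add _ _ _).symm

lemma Es_two (t : ℕ → V) (k : ℕ) :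
    Es t (k + 1) 2 = Es t k 2 + io (Ps t k) * io (t k) := by
  rw [Es_succ, Es_one]

lemma Es_comm (t : ℕ → V) (v : V) (k r : ℕ) :
    io v * Es t k r = (-1 : ℚ) ^ r • (Es t k r * io v) := by
  induction k generalizing r with
  | zero => cases r <;> simp [Es]
  | succ k ih =>
    cases r with
    | zero => simp [Es]
    | succ r =>
      rw [Es_succ, mul_add, ih, ← mul_assoc, ih, add_mul, smul_mul_assoc, mul_assoc, io_anti v,
        mul_assoc, mul_neg, pow_succ]
      module

lemma Es_even (t : ℕ → V) (v : V) (k j : ℕ) :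
    io v * Es t k (2 * j) = Es t k (2 * j) * io v := by
  rw [Es_comm]; simp

lemma Es_odd (t : ℕ → V) (v : V) (k j : ℕ) :
    io v * Es t k (2 * j + 1) = - (Es t k (2 * j + 1) * io v) := by
  rw [Es_comm]; simp [pow_succ]

lemma Es_odd_eq (t : ℕ → V) (k j : ℕ) : Es t k (2 * j + 1) = Es t k 1 * Es t k (2 * j) := by
  induction k generalizing j with
  | zero => simp [Es]
  | succ k ih =>
    cases j with
    | zero => simp [Es_zero]
    | succ j =>
      have h1 := ih (j + 1)
      have h0 := ih j
      have e : 2 * (j + 1) = 2 * j + 1 + 1 := by ring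
      rw [Es_succ, h1, Es_succ t k 0, Es_zero, one_mul, zero_add, add_mul]
      rw [e]
      rw [Es_succ t k (2 * j + 1), mul_add, mul_add, ← mul_assoc, h0, ← mul_assoc, ← mul_assoc,
        ← mul_assoc]
      have h2 : Es t k 1 * Es t k 1 = 0 := by rw [Es_one, io_sq]
      have h3 : io (t k) * Es t k (2 * j + 1 + 1) = Es t k (2 * j + 1 + 1) * io (t k) :=
        Es_even t (t k) k (j + 1)
      have h4 : io (t k) * Es t k 1 * Es t k (2 * j) * io (t k) = 0 := by
        rw [mul_assoc (io (t k)), ← h0, Es_odd, neg_mul, mul_assoc, io_sq, mul_zero, neg_zero]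
      rw [h2, h3, h4, zero_mul, zero_mul]
      abel

lemma Es_two_comm (t : ℕ → V) (v : V) (k : ℕ) : io v * Es t k 2 = Es t k 2 * io v :=
  Es_even t v k 1

lemma Es_even_eq (t : ℕ → V) (k j : ℕ) :
    ((j : ℚ) + 1) • Es t k (2 * j + 2) = Es t k 2 * Es t k (2 * j) := by
  induction k generalizing j with
  | zero => simp [Es]
  | succ k ih =>
    cases j with
    | zero => simp [Es_zero]
    | succ j =>
      have h1 := ih (j + 1)
      have h0 := ih j
      have hodd0 := Es_odd_eq t k j
      have e : 2 * (j + 1) = 2 * j + 1 + 1 := by ring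
      have hev : io (t k) * Es t k (2 * j + 1 + 1) = Es t k (2 * j + 1 + 1) * io (t k) :=
        Es_even t (t k) k (j + 1)
      have hodd : Es t k (2 * j + 1 + 1 + 1) = Es t k 1 * Es t k (2 * j + 1 + 1) :=
        Es_odd_eq t k (j + 1)
      rw [Es_succ t k (2 * (j + 1) + 1), smul_add, h1, Es_succ t k 1]
      rw [e]
      rw [Es_succ t k (2 * j + 1), mul_add, add_mul, add_mul]
      have h4 : Es t k 1 * io (t k) * (Es t k (2 * j + 1) * io (t k)) = 0 := by
        rw [mul_assoc, ← mul_assoc (io (t k)), Es_odd, neg_mul, mul_assoc (Es t k _), io_sq]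
        simp
      have h5 : Es t k 2 * (Es t k (2 * j + 1) * io (t k))
          = ((j : ℚ) + 1) • (Es t k (2 * j + 1 + 1 + 1) * io (t k)) := by
        rw [hodd, hodd0, Es_one, mul_assoc, ← mul_assoc (Es t k 2), ← Es_two_comm, mul_assoc,
          ← mul_assoc (Es t k 2), ← h0, smul_mul_assoc, mul_smul_comm, mul_assoc]
      have h6 : Es t k 1 * io (t k) * Es t k (2 * j + 1 + 1)
          = Es t k (2 * j + 1 + 1 + 1) * io (t k) := by
        rw [mul_assoc, hev, ← mul_assoc, ← hodd]
      rw [h4, h5, h6]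
      push_cast
      module

lemma om_Es (t : ℕ → V) (u : V) (k : ℕ) :
    ∑ i ∈ Finset.range k, io (t (2 * i) + Ps t (2 * i) - u) * io (t (2 * i + 1) - Ps t (2 * i) + u)
      = Es t (2 * k) 2 + io (Ps t (2 * k)) * io u := by
  induction k with
  | zero => simp [Es, Ps]
  | succ k ih =>
    rw [Finset.sum_range_succ, ih]
    have e : 2 * (k + 1) = 2 * k + 1 + 1 := by ring
    have hP : ∀ k, Ps t (k + 1) = Ps t k + t k := fun k => Finset.sum_range_succ _ _
    rw [e, Es_two, Es_two, hP (2 * k + 1), hP (2 * k)]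
    generalize t (2 * k) = a
    generalize t (2 * k + 1) = b
    generalize Ps t (2 * k) = P
    simp only [io, map_add, map_sub]
    change _ + (io a + io P - io u) * (io b - io P + io u) = _ + io P * io a +
      (io P + io a) * io b + (io P + io a + io b) * io u
    simp only [mul_add, add_mul, mul_sub, sub_mul, io_sq, io_anti a P, io_anti u P, io_anti u b]
    abel

lemma span_seq (t : ℕ → V) (u : V) (W : Submodule ℚ V) (m : ℕ) (hu : u ∈ W)
    (hx : ∀ i < m, t (2 * i) + Ps t (2 * i) - u ∈ W)
    (hy : ∀ i < m, t (2 * i + 1) - Ps t (2 * i) + u ∈ W) (k : ℕ) (hk : k ≤ m) :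
    ∀ j < 2 * k, t j ∈ W := by
  induction k with
  | zero => intro j hj; omega
  | succ k ih =>
    have ih := ih (by omega)
    have hP : Ps t (2 * k) ∈ W := Submodule.sum_mem _ fun j hj => ih j (by simpa using hj)
    have h1 : t (2 * k) ∈ W := by
      have := Submodule.add_mem _ (Submodule.sub_mem _ (hx k (by omega)) hP) hu
      convert this using 1; abel
    have h2 : t (2 * k + 1) ∈ W := by
      have := Submodule.sub_mem _ (Submodule.add_mem _ (hy k (by omega)) hP) hu
      convert this using 1; abel
    intro j hj
    rcases lt_or_ge j (2 * k) with h | h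
    · exact ih j h
    · rcases (by omega : j = 2 * k ∨ j = 2 * k + 1) with rfl | rfl <;> assumption

lemma NF.ofOdd [Module.Finite ℚ V] {m : ℕ} (hV : Module.finrank ℚ V = 2 * m + 1)
    (x y : Fin m → V) (z : V)
    (hs : ∀ W : Submodule ℚ V, (∀ i, x i ∈ W) → (∀ i, y i ∈ W) → z ∈ W → W = ⊤) :
    ∃ B : NF V m, B.x = x ∧ B.y = y ∧ B.z = z ∧ B.u = 0 := by
  let e : (Fin m ⊕ Fin m) ⊕ Unit → V := Sum.elim (Sum.elim x y) (fun _ => z)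
  have hspan : ⊤ ≤ Submodule.span ℚ (Set.range e) := by
    refine (hs _ ?_ ?_ ?_).ge
    · exact fun i => Submodule.subset_span ⟨.inl (.inl i), rfl⟩
    · exact fun i => Submodule.subset_span ⟨.inl (.inr i), rfl⟩
    · exact Submodule.subset_span ⟨.inr (), rfl⟩
  let b := basisOfTopLeSpanOfCardEqFinrank e hspan (by simp [hV]; ring)
  have hb : ⇑b = e := coe_basisOfTopLeSpanOfCardEqFinrank _ _ _
  have hx : ∀ i, x i = b (.inl (.inl i)) := fun i => by rw [hb]; rfl
  have hy : ∀ i, y i = b (.inl (.inr i)) := fun i => by rw [hb]; rfl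
  have hz : z = b (.inr ()) := by rw [hb]; rfl
  refine ⟨{ x := x, y := y, z := z, u := 0,
            f := fun i => b.coord (.inl (.inl i))
            g := fun i => b.coord (.inl (.inr i))
            ζ := b.coord (.inr ())
            υ := 0
            fx := ?_, fy := ?_, gx := ?_, gy := ?_, fz := ?_, gz := ?_, fu := ?_, gu := ?_
            ζx := ?_, ζy := ?_, ζz := ?_, ζu := ?_, υx := ?_, υy := ?_, υz := ?_, υu := ?_
            tot := ?_ }, rfl, rfl, rfl, rfl⟩
  case refine_17 =>
    intro v
    have h := b.sum_repr v
    simp only [Fintype.sum_sum_type, ← hx, ← hy, ← hz] at h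
    simpa [Finset.sum_add_distrib] using h
  all_goals
    intros
    simp [hx, hy, hz, Finsupp.single_apply, eq_comm]

lemma NF.ofEven [Module.Finite ℚ V] {m : ℕ} (hV : Module.finrank ℚ V = 2 * m + 2)
    (x y : Fin m → V) (z u : V)
    (hs : ∀ W : Submodule ℚ V, (∀ i, x i ∈ W) → (∀ i, y i ∈ W) → z ∈ W → u ∈ W → W = ⊤) :
    ∃ B : NF V m, B.x = x ∧ B.y = y ∧ B.z = z ∧ B.u = u := by
  let e : (Fin m ⊕ Fin m) ⊕ (Unit ⊕ Unit) → V :=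
    Sum.elim (Sum.elim x y) (Sum.elim (fun _ => z) (fun _ => u))
  have hspan : ⊤ ≤ Submodule.span ℚ (Set.range e) := by
    refine (hs _ ?_ ?_ ?_ ?_).ge
    · exact fun i => Submodule.subset_span ⟨.inl (.inl i), rfl⟩
    · exact fun i => Submodule.subset_span ⟨.inl (.inr i), rfl⟩
    · exact Submodule.subset_span ⟨.inr (.inl ()), rfl⟩
    · exact Submodule.subset_span ⟨.inr (.inr ()), rfl⟩
  let b := basisOfTopLeSpanOfCardEqFinrank e hspan (by simp [hV]; ring)
  have hb : ⇑b = e := coe_basisOfTopLeSpanOfCardEqFinrank _ _ _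
  have hx : ∀ i, x i = b (.inl (.inl i)) := fun i => by rw [hb]; rfl
  have hy : ∀ i, y i = b (.inl (.inr i)) := fun i => by rw [hb]; rfl
  have hz : z = b (.inr (.inl ())) := by rw [hb]; rfl
  have hu : u = b (.inr (.inr ())) := by rw [hb]; rfl
  refine ⟨{ x := x, y := y, z := z, u := u,
            f := fun i => b.coord (.inl (.inl i))
            g := fun i => b.coord (.inl (.inr i))
            ζ := b.coord (.inr (.inl ()))
            υ := b.coord (.inr (.inr ()))
            fx := ?_, fy := ?_, gx := ?_, gy := ?_, fz := ?_, gz := ?_, fu := ?_, gu := ?_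
            ζx := ?_, ζy := ?_, ζz := ?_, ζu := ?_, υx := ?_, υy := ?_, υz := ?_, υu := ?_
            tot := ?_ }, rfl, rfl, rfl, rfl⟩
  case refine_17 =>
    intro v
    have h := b.sum_repr v
    simp only [Fintype.sum_sum_type, ← hx, ← hy, ← hz, ← hu] at h
    simpa [Finset.sum_add_distrib, add_assoc] using h
  all_goals
    intros
    simp [hx, hy, hz, hu, Finsupp.single_apply, eq_comm]

end Seq

section Conc

/-- The standard basis as a sequence. -/
noncomputable def tt (n : ℕ) (j : ℕ) : Fin n → ℚ :=
  if h : j < n then Pi.single ⟨j, h⟩ 1 else 0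

lemma thetaA_insert (n : ℕ) (A : Finset (Fin n)) (a : Fin n) (h : ∀ b ∈ A, b < a) :
    thetaA n (insert a A) = thetaA n A * theta n a := by
  have ha : a ∉ A := fun h' => lt_irrefl _ (h a h')
  have : (insert a A).sort (· ≤ ·) = A.sort (· ≤ ·) ++ [a] := by
    refine List.Perm.eq_of_pairwise' (r := (· ≤ ·)) ?_ ?_ ?_
    · exact Finset.pairwise_sort _ _
    · rw [List.pairwise_append]
      refine ⟨Finset.pairwise_sort _ _, by simp, ?_⟩
      intro b hb c hc
      simp at hb hc
      subst hc
      exact (h b hb).le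
    · rw [List.perm_ext_iff_of_nodup]
      · intro b; simp [or_comm]
      · exact Finset.sort_nodup _ _
      · rw [List.nodup_append]
        refine ⟨Finset.sort_nodup _ _, by simp, ?_⟩
        intro b hb c hc
        simp at hb hc
        subst hc
        exact (h b hb).ne
  rw [thetaA, this]
  simp [thetaA]

lemma Fq_aux (n k r : ℕ) (hk : k ≤ n) :
    ∑ A ∈ Finset.powersetCard r (Finset.univ.filter fun i : Fin n => i.val < k), thetaA n A
      = Es (tt n) k r := by
  induction k generalizing r with
  | zero => 
    cases r with
    | zero => simp [Es, thetaA]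
    | succ r => 
      rw [Finset.powersetCard_eq_empty.2 (by simp)]
      simp [Es]
  | succ k ih =>
    cases r with
    | zero => simp [Es, thetaA]
    | succ r =>
      have ih := fun r => ih r (by omega)
      have e : (Finset.univ.filter fun i : Fin n => i.val < k + 1)
          = insert ⟨k, hk⟩ (Finset.univ.filter fun i : Fin n => i.val < k) := by
        ext i; simp [Fin.ext_iff]; omega
      have hn : (⟨k, hk⟩ : Fin n) ∉ (Finset.univ.filter fun i : Fin n => i.val < k) := by simp
      rw [e, Finset.powersetCard_succ_insert hn, Finset.sum_union, ih, Es_succ, Finset.sum_image,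
        ← ih r, Finset.sum_mul]
      · congr 1
        refine Finset.sum_congr rfl fun A hA => ?_
        rw [thetaA_insert]
        · simp [theta, tt, io, show k < n from hk]
        · intro b hb
          have := (Finset.mem_powersetCard.1 hA).1 hb
          simpa [Fin.lt_def] using this
      · intro A hA A' hA' h
        have h1 : (⟨k, hk⟩ : Fin n) ∉ A := fun h' => hn ((Finset.mem_powersetCard.1 hA).1 h')
        have h2 : (⟨k, hk⟩ : Fin n) ∉ A' := fun h' => hn ((Finset.mem_powersetCard.1 hA').1 h')
        rw [← Finset.erase_insert h1, ← Finset.erase_insert h2]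
        rw [h]
      · rw [Finset.disjoint_left]
        intro A hA hA'
        obtain ⟨A', _, rfl⟩ := Finset.mem_image.1 hA'
        exact hn ((Finset.mem_powersetCard.1 hA).1 (Finset.mem_insert_self _ _))

lemma Fq_eq (n r : ℕ) : Fq n r = Es (tt n) n r := by
  rw [← Fq_aux n n r le_rfl, Fq]
  simp

lemma tt_top (n : ℕ) (W : Submodule ℚ (Fin n → ℚ)) (h : ∀ j < n, tt n j ∈ W) : W = ⊤ := by
  rw [eq_top_iff, ← (Pi.basisFun ℚ (Fin n)).span_eq, Submodule.span_le]
  rintro _ ⟨i, rfl⟩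
  have := h i i.2
  simpa [tt] using this

/-- Existence of the normal form. -/
lemma exists_NF (n : ℕ) (hn : 1 ≤ n) : ∃ B : NF (Fin n → ℚ) ((n - 1) / 2),
    B.z = Ps (tt n) n ∧ Es (tt n) n 2 = B.om + io B.z * io (tt n (n - 1)) ∧
    (B.u = 0 ∨ n % 2 = 0) := by
  have hP : ∀ k, Ps (tt n) (k + 1) = Ps (tt n) k + tt n k := fun k => Finset.sum_range_succ _ _
  have hom : ∀ k (v : Fin n → ℚ), io (Ps (tt n) k + v) * io v = io (Ps (tt n) k) * io v := by
    intro k v; simp only [io, map_add, add_mul]; erw [io_sq]; rw [add_zero]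
  obtain ⟨m, h | h⟩ : ∃ m, n = 2 * m + 1 ∨ n = 2 * m + 2 := ⟨(n - 1) / 2, by omega⟩
  · have hm : (n - 1) / 2 = m := by omega
    rw [hm]
    obtain ⟨B, hx, hy, hz, hu⟩ := NF.ofOdd (V := Fin n → ℚ) (m := m) (by simp [h])
      (fun i => tt n (2 * i) + Ps (tt n) (2 * i) - 0)
      (fun i => tt n (2 * i + 1) - Ps (tt n) (2 * i) + 0) (Ps (tt n) n) (by
        intro W h1 h2 h3
        have h4 := span_seq (tt n) 0 W m W.zero_mem (fun i hi => h1 ⟨i, hi⟩)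
          (fun i hi => h2 ⟨i, hi⟩) m le_rfl
        apply tt_top
        intro j hj
        rcases lt_or_ge j (2 * m) with h5 | h5
        · exact h4 j h5
        · have h6 : j = 2 * m := by omega
          subst h6
          have h7 : Ps (tt n) (2 * m) ∈ W :=
            Submodule.sum_mem _ fun j hj => h4 j (by simpa using hj)
          have h8 := hP (2 * m)
          rw [← h] at h8
          rw [h8] at h3
          exact (Submodule.add_mem_iff_right _ h7).1 h3)
    refine ⟨B, hz, ?_, Or.inl hu⟩
    have e := om_Es (tt n) 0 m
    rw [Finset.sum_range] at e
    rw [NF.om, hx, hy, hz, e]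
    have h8 := hP (2 * m)
    rw [← h] at h8
    have h9 := Es_two (tt n) (2 * m)
    rw [← h] at h9
    have h10 : n - 1 = 2 * m := by omega
    rw [h9, h10, h8, hom]
    simp
  · have hm : (n - 1) / 2 = m := by omega
    rw [hm]
    obtain ⟨B, hx, hy, hz, hu⟩ := NF.ofEven (V := Fin n → ℚ) (m := m) (by simp [h])
      (fun i => tt n (2 * i) + Ps (tt n) (2 * i) - tt n (2 * m))
      (fun i => tt n (2 * i + 1) - Ps (tt n) (2 * i) + tt n (2 * m)) (Ps (tt n) n)
      (tt n (2 * m)) (by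
        intro W h1 h2 h3 h0
        have h4 := span_seq (tt n) _ W m h0 (fun i hi => h1 ⟨i, hi⟩)
          (fun i hi => h2 ⟨i, hi⟩) m le_rfl
        apply tt_top
        intro j hj
        rcases lt_or_ge j (2 * m) with h5 | h5
        · exact h4 j h5
        · have h7 : Ps (tt n) (2 * m + 1) ∈ W :=
            hP (2 * m) ▸ W.add_mem (Submodule.sum_mem _ fun j hj => h4 j (by simpa using hj)) h0
          rcases (by omega : j = 2 * m ∨ j = 2 * m + 1) with h6 | h6
          · rw [h6]; exact h0
          subst h6
          have h8 := hP (2 * m + 1)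
          rw [← h] at h8
          rw [h8] at h3
          exact (Submodule.add_mem_iff_right _ h7).1 h3)
    refine ⟨B, hz, ?_, Or.inr (by omega)⟩
    have e := om_Es (tt n) (tt n (2 * m)) m
    rw [Finset.sum_range] at e
    rw [NF.om, hx, hy, hz, e]
    have h8 := hP (2 * m + 1)
    rw [← h] at h8
    have h9 := Es_two (tt n) (2 * m + 1)
    rw [← h, Es_two] at h9
    have h10 : n - 1 = 2 * m + 1 := by omega
    rw [h9, h10, h8, hom]

end Conc
section Final

instance finExt (n : ℕ) : Module.Finite ℚ (ExteriorAlgebra ℚ (Fin n → ℚ)) :=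
  Module.Finite.of_basis (Pi.basisFun ℚ (Fin n)).ExteriorAlgebra

/-- Projection to a graded piece. -/
noncomputable def pr (n k : ℕ) : ExteriorAlgebra ℚ (Fin n → ℚ) →ₗ[ℚ] ExteriorAlgebra ℚ (Fin n → ℚ) :=
    (gradePiece n k).subtype ∘ₗ
      (DirectSum.component ℚ ℕ (fun i => ⋀[ℚ]^i (Fin n → ℚ)) k) ∘ₗ
      (DirectSum.decomposeLinearEquiv (fun i => ⋀[ℚ]^i (Fin n → ℚ))).toLinearMap

lemma pr_apply (n k : ℕ) (a : ExteriorAlgebra ℚ (Fin n → ℚ)) :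
    pr n k a = (DirectSum.decompose (fun i => ⋀[ℚ]^i (Fin n → ℚ)) a k : _) := rfl

lemma pr_mem (n k : ℕ) (a : ExteriorAlgebra ℚ (Fin n → ℚ)) : pr n k a ∈ gradePiece n k :=
  (DirectSum.decompose (fun i => ⋀[ℚ]^i (Fin n → ℚ)) a k).2

lemma pr_of_mem (n k l : ℕ) (a : ExteriorAlgebra ℚ (Fin n → ℚ)) (ha : a ∈ gradePiece n l) :
    pr n k a = if k = l then a else 0 := by
  split_ifs with h
  · subst h
    exact DirectSum.decompose_of_mem_same (fun i => ⋀[ℚ]^i (Fin n → ℚ)) ha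
  · exact DirectSum.decompose_of_mem_ne (fun i => ⋀[ℚ]^i (Fin n → ℚ)) ha (Ne.symm h)

lemma grade_ind {n : ℕ} {p : ExteriorAlgebra ℚ (Fin n → ℚ) → Prop} (h0 : p 0)
    (hm : ∀ k, ∀ a ∈ gradePiece n k, p a) (ha : ∀ a b, p a → p b → p (a + b)) (a) : p a := by
  induction a using DirectSum.Decomposition.inductionOn (fun i => ⋀[ℚ]^i (Fin n → ℚ)) with
  | zero => exact h0
  | homogeneous a => exact hm _ _ a.2
  | add a b h1 h2 => exact ha _ _ h1 h2

lemma mem_of_pr (n : ℕ) (W : Submodule ℚ (ExteriorAlgebra ℚ (Fin n → ℚ)))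
    (a : ExteriorAlgebra ℚ (Fin n → ℚ)) (h : ∀ k, pr n k a ∈ W) : a ∈ W := by
  classical
  rw [← DirectSum.sum_support_decompose (fun i => ⋀[ℚ]^i (Fin n → ℚ)) a]
  exact Submodule.sum_mem _ fun k _ => h k

lemma finrank_grade (n k : ℕ) : Module.finrank ℚ (gradePiece n k) = n.choose k := by
  have := exteriorPower.finrank_eq ℚ (M := Fin n → ℚ) k
  rw [Module.finrank_fin_fun] at this
  exact this

lemma count (n : ℕ) (W : Submodule ℚ (ExteriorAlgebra ℚ (Fin n → ℚ)))
    (hom : ∀ a ∈ W, ∀ k, pr n k a ∈ W)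
    (top : ∀ k, n < 2 * k → gradePiece n k ≤ W)
    (dim : ∀ k, 2 * k ≤ n → Module.finrank ℚ (W ⊓ gradePiece n k : Submodule ℚ _)
      = if k = 0 then 0 else n.choose (k - 1)) :
    Module.finrank ℚ (ExteriorAlgebra ℚ (Fin n → ℚ) ⧸ W) = n.choose (n / 2) ∧
    ∀ k : ℕ,
      Module.finrank ℚ (Submodule.map W.mkQ (gradePiece n k))
        = if k ≤ n / 2 then n.choose k - (if k = 0 then 0 else n.choose (k - 1))
          else 0 := by
  have part2 : ∀ k : ℕ,
      Module.finrank ℚ (Submodule.map W.mkQ (gradePiece n k))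
        = if k ≤ n / 2 then n.choose k - (if k = 0 then 0 else n.choose (k - 1))
          else 0 := by
    intro k
    by_cases h1 : k ≤ n / 2
    · rw [if_pos h1]
      have e := LinearMap.finrank_range_add_finrank_ker (W.mkQ.domRestrict (gradePiece n k))
      rw [LinearMap.range_domRestrict, LinearMap.ker_domRestrict, Submodule.ker_mkQ,
        finrank_grade] at e
      have e2 : Module.finrank ℚ (Submodule.comap (gradePiece n k).subtype W)
          = Module.finrank ℚ (W ⊓ gradePiece n k : Submodule ℚ _) := by
        rw [inf_comm, ← Submodule.map_comap_subtype]
        exact (Submodule.equivMapOfInjective _ (Submodule.subtype_injective _) _).finrank_eq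
      rw [e2, dim k (by omega)] at e
      omega
    · rw [if_neg h1]
      have : Submodule.map W.mkQ (gradePiece n k) = ⊥ := by
        rw [eq_bot_iff]
        rintro _ ⟨a, ha, rfl⟩
        rw [Submodule.mem_bot, Submodule.mkQ_apply, Submodule.Quotient.mk_eq_zero]
        exact top k (by omega) ha
      rw [this, finrank_bot]
  refine ⟨?_, part2⟩
  let Φ : ExteriorAlgebra ℚ (Fin n → ℚ) →ₗ[ℚ]
      ((k : Fin (n + 1)) → Submodule.map W.mkQ (gradePiece n k)) :=
    LinearMap.pi fun k => LinearMap.codRestrict _ (W.mkQ ∘ₗ pr n k)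
      (fun a => ⟨pr n k a, pr_mem n k a, rfl⟩)
  have hΦ : ∀ a k, (Φ a k : ExteriorAlgebra ℚ (Fin n → ℚ) ⧸ W) = W.mkQ (pr n k a) :=
    fun a k => rfl
  have hker : LinearMap.ker Φ = W := by
    ext a
    rw [LinearMap.mem_ker]
    constructor
    · intro h
      apply mem_of_pr
      intro k
      by_cases hk : k < n + 1
      · have := hΦ a ⟨k, hk⟩
        rw [h] at this
        rw [← Submodule.Quotient.mk_eq_zero]
        exact this.symm
      · exact top k (by omega) (pr_mem n k a)
    · intro h
      ext k
      rw [hΦ]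
      simpa using hom a h k
  have hsurj : Function.Surjective Φ := by
    intro q
    choose g hg hq using fun k => (q k).2
    refine ⟨∑ k, g k, ?_⟩
    ext k
    rw [hΦ, map_sum, ← hq k]
    congr 1
    rw [Finset.sum_eq_single k]
    · rw [pr_of_mem n k k _ (hg k), if_pos rfl]
    · intro l _ hl
      rw [pr_of_mem n k l _ (hg l), if_neg]
      intro h
      exact hl (Fin.ext h.symm)
    · simp
  have e := (Φ.quotKerEquivOfSurjective hsurj).finrank_eq
  rw [hker, Module.finrank_pi_fintype] at e
  rw [e]
  simp only [part2]
  rw [Fin.sum_univ_eq_sum_range (fun k => if k ≤ n / 2 then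
    n.choose k - (if k = 0 then 0 else n.choose (k - 1)) else 0) (n + 1)]
  rw [← Finset.sum_filter]
  have e2 : (Finset.range (n + 1)).filter (fun k => k ≤ n / 2) = Finset.range (n / 2 + 1) := by
    ext k; simp; omega
  rw [e2]
  have e3 : ∀ j, j ≤ n / 2 → ∑ k ∈ Finset.range (j + 1),
      (n.choose k - (if k = 0 then 0 else n.choose (k - 1))) = n.choose j := by
    intro j hj
    induction j with
    | zero => simp
    | succ j ih =>
      rw [Finset.sum_range_succ, ih (by omega)]
      have := Nat.choose_le_succ_of_lt_half_left (r := j) (n := n) (by omega)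
      simp
      omega
  exact e3 _ le_rfl

lemma In_zero : In 0 = ⊥ := by
  rw [In, Submodule.span_eq_bot]
  intro x hx
  have h2 := TwoSidedIdeal.mem_span_iff.1 hx ⊥ (by
    rintro _ ⟨r, h1, h2, _⟩; omega)
  simpa using h2

lemma In_eq (n : ℕ) (m : ℕ) (B : NF (Fin n → ℚ) m) (hn : 1 ≤ n) (hz : B.z = Ps (tt n) n)
    (hom : Es (tt n) n 2 = B.om + io B.z * io (tt n (n - 1))) :
    In n = LinearMap.range B.D := by
  have hF2 : Es (tt n) n 2 ∈ LinearMap.range B.D := by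
    rw [hom]
    refine Submodule.add_mem _ ?_ (B.z_mem _)
    simpa using B.om_mem 1
  apply le_antisymm
  · rw [In, Submodule.span_le]
    intro x hx
    replace hx : x ∈ TwoSidedIdeal.span {x | ∃ r : ℕ, 1 ≤ r ∧ r ≤ n ∧ x = Fq n r} := hx
    change x ∈ LinearMap.range B.D
    induction hx using TwoSidedIdeal.span_induction with
    | mem x h =>
      obtain ⟨r, h1, _, rfl⟩ := h
      rw [Fq_eq]
      obtain ⟨j, rfl | rfl⟩ : ∃ j, r = 2 * j + 1 ∨ r = 2 * j + 2 := ⟨(r - 1) / 2, by omega⟩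
      · rw [Es_odd_eq, Es_one, ← hz]
        exact B.z_mem _
      · have hne : ((j : ℚ) + 1) ≠ 0 := by positivity
        rw [← Submodule.smul_mem_iff _ hne, Es_even_eq]
        exact B.range_mul_right _ _ hF2
    | zero => exact Submodule.zero_mem _
    | add x y _ _ h1 h2 => exact Submodule.add_mem _ h1 h2
    | neg x _ h => exact Submodule.neg_mem _ h
    | left_absorb a x _ h => exact B.range_mul_left _ _ h
    | right_absorb b x _ h => exact B.range_mul_right _ _ h
  · intro x hx
    rw [B.mem_range] at hx
    obtain ⟨b, c, rfl⟩ := hx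
    apply Submodule.subset_span
    have h1 : io B.z ∈ TwoSidedIdeal.span {x | ∃ r : ℕ, 1 ≤ r ∧ r ≤ n ∧ x = Fq n r} :=
      TwoSidedIdeal.subset_span ⟨1, le_rfl, hn, by rw [Fq_eq, Es_one, hz]⟩
    have h2 : Es (tt n) n 2 ∈ TwoSidedIdeal.span {x | ∃ r : ℕ, 1 ≤ r ∧ r ≤ n ∧ x = Fq n r} := by
      by_cases h : 2 ≤ n
      · exact TwoSidedIdeal.subset_span ⟨2, by omega, h, by rw [Fq_eq]⟩
      · have : Es (tt n) n 2 = 0 := by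
          obtain rfl : n = 1 := by omega
          simp [Es]
        rw [this]
        exact TwoSidedIdeal.zero_mem _
    have h3 : B.om ∈ TwoSidedIdeal.span {x | ∃ r : ℕ, 1 ≤ r ∧ r ≤ n ∧ x = Fq n r} := by
      rw [eq_sub_of_add_eq hom.symm]
      exact TwoSidedIdeal.sub_mem _ h2 (TwoSidedIdeal.mul_mem_right _ _ _ h1)
    exact TwoSidedIdeal.add_mem _ (TwoSidedIdeal.mul_mem_right _ _ _ h1)
      (TwoSidedIdeal.mul_mem_right _ _ _ h3)

lemma pr_D (n m : ℕ) (B : NF (Fin n → ℚ) m) (a : ExteriorAlgebra ℚ (Fin n → ℚ)) :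
    pr n 0 (B.D a) = 0 ∧ ∀ k, pr n (k + 1) (B.D a) = B.D (pr n k a) := by
  induction a using grade_ind with
  | h0 => simp
  | hm l a ha =>
    have h : B.D a ∈ gradePiece n (l + 1) := B.D_grade l a ha
    refine ⟨?_, fun k => ?_⟩
    · rw [pr_of_mem n 0 _ _ h]; simp
    · rw [pr_of_mem n _ _ _ h, pr_of_mem n _ _ _ ha]
      by_cases h : k = l <;> simp [h]
  | ha a b h1 h2 =>
    refine ⟨?_, fun k => ?_⟩
    · rw [map_add, map_add, h1.1, h2.1, add_zero]
    · rw [map_add, map_add, h1.2, h2.2, map_add, map_add]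

end Final

/-- The quotient `Λ(ℚ^n)/I_n` has dimension `C(n, ⌊n/2⌋)` over `ℚ`, and its Hilbert
series is `Σ_{k=0}^{⌊n/2⌋} (C(n,k) - C(n,k-1)) q^k`: the degree-`k` component of the
quotient has dimension `C(n,k) - C(n,k-1)` for `k ≤ ⌊n/2⌋` and `0` for `k > ⌊n/2⌋`
(with the convention `C(n,-1) = 0`). -/
theorem stmt19 (n : ℕ) :
    Module.finrank ℚ (ExteriorAlgebra ℚ (Fin n → ℚ) ⧸ In n) = n.choose (n / 2) ∧
    ∀ k : ℕ,
      Module.finrank ℚ (Submodule.map (In n).mkQ (gradePiece n k))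
        = if k ≤ n / 2 then n.choose k - (if k = 0 then 0 else n.choose (k - 1))
          else 0 := by
  rcases Nat.eq_zero_or_pos n with rfl | hn
  · apply count
    · intro a ha k
      rw [In_zero, Submodule.mem_bot] at *
      rw [ha, map_zero]
    · intro k hk
      have h := finrank_grade 0 k
      rw [Nat.choose_eq_zero_of_lt (by omega)] at h
      rw [Submodule.finrank_eq_zero.1 h]
      exact bot_le
    · intro k hk
      rw [In_zero, bot_inf_eq, finrank_bot, if_pos (by omega)]
  · obtain ⟨B, hz, hom, hu⟩ := exists_NF n hn
    have hI := In_eq n _ B hn hz hom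
    apply count
    · intro a ha k
      rw [hI] at *
      obtain ⟨a, rfl⟩ := ha
      cases k with
      | zero => rw [(pr_D n _ B a).1]; exact Submodule.zero_mem _
      | succ k => rw [(pr_D n _ B a).2]; exact ⟨_, rfl⟩
    · intro k hk a ha
      rw [hI]
      refine B.D_surj k (by omega) (hu.imp id fun h => by omega) a ha
    · intro k hk
      rw [hI]
      cases k with
      | zero =>
        rw [if_pos rfl]
        have : LinearMap.range B.D ⊓ gradePiece n 0 = ⊥ := by
          rw [eq_bot_iff]
          rintro _ ⟨⟨a, rfl⟩, h⟩
          rw [Submodule.mem_bot, ← (pr_D n _ B a).1, pr_of_mem n 0 0 _ h, if_pos rfl]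
        rw [this, finrank_bot]
      | succ k =>
        have : LinearMap.range B.D ⊓ gradePiece n (k + 1)
            = Submodule.map B.D (gradePiece n k) := by
          apply le_antisymm
          · rintro _ ⟨⟨a, rfl⟩, h⟩
            refine ⟨pr n k a, pr_mem n k a, ?_⟩
            rw [← (pr_D n _ B a).2, pr_of_mem n _ _ _ h, if_pos rfl]
          · rintro _ ⟨a, ha, rfl⟩
            exact ⟨⟨a, rfl⟩, B.D_grade k a ha⟩
        rw [this, if_neg (by omega), Nat.add_sub_cancel, ← finrank_grade n k,
          ← LinearMap.range_domRestrict]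
        apply LinearMap.finrank_range_of_inj
        rw [← LinearMap.ker_eq_bot, eq_bot_iff]
        rintro ⟨a, ha⟩ h
        rw [LinearMap.mem_ker, LinearMap.domRestrict_apply] at h
        rw [Submodule.mem_bot]
        exact Subtype.ext (B.D_inj k (by omega) a ha h)
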